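/- Let p : ℂ → ℝ be a real-analytic function of the form p(z) = Σ_{j,k} c_{jk̄} z^j conj(z)^k (finite sum, c Hermitian) with p ≥ 0 and p not identically zero. Then there is a unique nonnegative integer m such that p(z)/|z|^{2m} extends to a function that is bounded and bounded away from 0 in some punctured neighborhood of 0, provided p is of the form p = (Σ_δ |T^δ|²)/(Σ_γ |s^γ|²) near 0 for holomorphic functions T^δ, s^γ with Σ_γ |s^γ|² not vanishing identically. -/

import Mathlib

open Finset ComplexConjugate

open Polynomial in
/-- A nonzero polynomial is not a zero divisor on functions continuous on an open set. -/
lemma Polynomial.eq_zero_of_eval_mul_eq_zero {V : Set ℂ} (hV : IsOpen V) {f : ℂ → ℂ}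
    (hf : ContinuousOn f V) {q : ℂ[X]} (h : ∀ z ∈ V, q.eval z * f z = 0)
    {x : ℂ} (hx : x ∈ V) (hfx : f x ≠ 0) : q = 0 := by
  have hnhds : ∀ᶠ z in nhds x, z ∈ V ∧ f z ≠ 0 :=
    Filter.Eventually.and (hV.mem_nhds hx) ((hf.continuousAt (hV.mem_nhds hx)).eventually_ne hfx)
  refine Polynomial.eq_zero_of_infinite_isRoot q ((infinite_of_mem_nhds x hnhds).mono ?_)
  rintro z ⟨hz, hfz⟩
  exact (mul_eq_zero.mp (h z hz)).resolve_right hfz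

/-- Over a principal ideal domain, a finite family in a torsion-free module maps to a family of
scalars satisfying the same linear relations, with a prescribed nonzero member staying nonzero. -/
lemma exists_family_of_isTorsionFree {R M ι : Type*} [CommRing R] [IsDomain R]
    [IsPrincipalIdealRing R] [AddCommGroup M] [Module R M] [Module.IsTorsionFree R M] [Fintype ι]
    (F : ι → M) {i₀ : ι} (hi₀ : F i₀ ≠ 0) :
    ∃ g : ι → R, g i₀ ≠ 0 ∧ ∀ Q : ι → R, ∑ i, Q i • F i = 0 → ∑ i, Q i * g i = 0 := by
  let N : Submodule R M := Submodule.span R (Set.range F)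
  have : Module.Finite R N := Module.Finite.span_of_finite _ (Set.finite_range F)
  let G : ι → N := fun i => ⟨F i, Submodule.subset_span ⟨i, rfl⟩⟩
  let b := Module.Free.chooseBasis R N
  obtain ⟨j, hj⟩ : ∃ j, b.coord j (G i₀) ≠ 0 := by
    by_contra! hall
    exact hi₀ (congrArg Subtype.val (b.forall_coord_eq_zero_iff.mp hall))
  refine ⟨fun i => b.coord j (G i), hj, fun Q hQ => ?_⟩
  have hsum : ∑ i, Q i • G i = 0 := Subtype.ext (by simpa [G] using hQ)
  simpa using congrArg (b.coord j) hsum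

open Polynomial in
/-- A finite family of continuous functions on an open set maps to a family of polynomials
satisfying the same polynomial linear relations, with a prescribed nonzero member staying nonzero:
the functions span a finite torsion-free, hence free, `ℂ[X]`-module. -/
lemma exists_polynomial_family_of_continuousOn {ι : Type*} [Fintype ι] {V : Set ℂ}
    (hV : IsOpen V) (f : ι → ℂ → ℂ) (hf : ∀ i, ContinuousOn (f i) V)
    (i₀ : ι) {x₀ : ℂ} (hx₀ : x₀ ∈ V) (hi₀ : f i₀ x₀ ≠ 0) :
    ∃ g : ι → ℂ[X], g i₀ ≠ 0 ∧ ∀ Q : ι → ℂ[X],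
      (∀ z ∈ V, ∑ i, (Q i).eval z * f i z = 0) → ∑ i, Q i * g i = 0 := by
  let _ : Module ℂ[X] C(V, ℂ) := Module.compHom _ (toContinuousMapOnAlgHom V).toRingHom
  have smul_apply (q : ℂ[X]) (u : C(V, ℂ)) (z : V) : (q • u) z = q.eval (z : ℂ) * u z := rfl
  have : Module.IsTorsionFree ℂ[X] C(V, ℂ) := by
    refine Module.IsTorsionFree.of_smul_eq_zero fun q u hqu => ?_
    by_contra! hcon
    obtain ⟨hq, hu⟩ := hcon
    obtain ⟨x, hx⟩ : ∃ x, u x ≠ 0 := by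
      by_contra! hall
      exact hu (ContinuousMap.ext hall)
    classical
    let w : ℂ → ℂ := fun z => if hz : z ∈ V then u ⟨z, hz⟩ else 0
    have hw : ContinuousOn w V := by
      rw [continuousOn_iff_continuous_domRestrict]
      convert u.continuous using 1
      ext z
      simp [w]
    refine hq (eq_zero_of_eval_mul_eq_zero hV hw (fun z hz => ?_) x.2 (by simpa [w] using hx))
    have := congrArg (fun v : C(V, ℂ) => v ⟨z, hz⟩) hqu
    simpa [w, hz, smul_apply] using this
  let F : ι → C(V, ℂ) := fun i => ⟨V.domRestrict (f i), (hf i).domRestrict⟩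
  have hFz (i : ι) (z : V) : F i z = f i z := rfl
  obtain ⟨g, hg₀, hg⟩ := exists_family_of_isTorsionFree (R := ℂ[X]) F (i₀ := i₀) fun h => hi₀ <|
    congrArg (fun v : C(V, ℂ) => v ⟨x₀, hx₀⟩) h
  refine ⟨g, hg₀, fun Q hQ => hg Q ?_⟩
  ext z
  simpa [smul_apply, hFz] using hQ z z.2

/-- A holomorphic function on a disc centred at `0` that vanishes on the real diameter vanishes. -/
lemma eq_zero_of_eq_zero_on_real {ρ : ℝ} {f : ℂ → ℂ}
    (hf : DifferentiableOn ℂ f (Metric.ball 0 ρ))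
    (h : ∀ t : ℝ, |t| < ρ → f t = 0) {x : ℂ} (hx : x ∈ Metric.ball (0 : ℂ) ρ) : f x = 0 := by
  have hρ : 0 < ρ := Metric.pos_of_mem_ball hx
  refine (hf.analyticOnNhd Metric.isOpen_ball).eqOn_zero_of_preconnected_of_frequently_eq_zero
    (convex_ball _ _).isPreconnected (Metric.mem_ball_self hρ) ?_ hx
  have htend : Filter.Tendsto (fun t : ℝ => (t : ℂ)) (nhdsWithin 0 {0}ᶜ) (nhdsWithin 0 {0}ᶜ) := by
    refine tendsto_nhdsWithin_iff.mpr ⟨?_, ?_⟩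
    · exact (Complex.continuous_ofReal.tendsto' 0 0 (by simp)).mono_left nhdsWithin_le_nhds
    · filter_upwards [self_mem_nhdsWithin] with t ht
      simpa using ht
  refine htend.frequently (Filter.Eventually.frequently ?_)
  filter_upwards [nhdsWithin_le_nhds (Metric.ball_mem_nhds (0 : ℝ) hρ)] with t ht
  exact h t (by simpa using ht)

/-- Polarization: a holomorphic function of `(z, w)` vanishing on `w = conj z` vanishes nearby. -/
lemma eq_zero_of_eq_zero_on_conj {z₀ : ℂ} {ρ : ℝ} {F : ℂ × ℂ → ℂ}
    (hF : DifferentiableOn ℂ F (Metric.ball z₀ (2 * ρ) ×ˢ Metric.ball (conj z₀) (2 * ρ)))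
    (h : ∀ z ∈ Metric.ball z₀ (2 * ρ), F (z, conj z) = 0)
    {a b : ℂ} (ha : a ∈ Metric.ball z₀ ρ) (hb : b ∈ Metric.ball (conj z₀) ρ) : F (a, b) = 0 := by
  let H : ℂ → ℂ → ℂ := fun x y =>
    F (z₀ + (x + Complex.I * y), conj z₀ + (x - Complex.I * y))
  have hmaps {x y : ℂ} (hx : x ∈ Metric.ball (0 : ℂ) ρ) (hy : y ∈ Metric.ball (0 : ℂ) ρ) :
      (z₀ + (x + Complex.I * y), conj z₀ + (x - Complex.I * y)) ∈
        Metric.ball z₀ (2 * ρ) ×ˢ Metric.ball (conj z₀) (2 * ρ) := by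
    rw [mem_ball_zero_iff] at hx hy
    have h₁ := norm_add_le x (Complex.I * y)
    have h₂ := norm_sub_le x (Complex.I * y)
    simp only [norm_mul, Complex.norm_I, one_mul] at h₁ h₂
    simp only [Set.mem_prod, Metric.mem_ball, dist_self_add_left]
    constructor <;> linarith
  have hreal (t u : ℝ) (ht : |t| < ρ) (hu : |u| < ρ) : H t u = 0 := by
    have hmem := (hmaps (x := t) (y := u) (by simpa using ht) (by simpa using hu)).1
    have := h _ hmem
    simpa [H, sub_eq_add_neg] using this
  have hleft (u : ℝ) (hu : |u| < ρ) {x : ℂ} (hx : x ∈ Metric.ball (0 : ℂ) ρ) : H x u = 0 := by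
    refine eq_zero_of_eq_zero_on_real (f := fun x => H x u) ?_ (fun t ht => hreal t u ht hu) hx
    refine hF.comp (f := fun x : ℂ => (z₀ + (x + Complex.I * u), conj z₀ + (x - Complex.I * u)))
      (by fun_prop) fun x hx => hmaps hx (by simpa using hu)
  have hall {x y : ℂ} (hx : x ∈ Metric.ball (0 : ℂ) ρ) (hy : y ∈ Metric.ball (0 : ℂ) ρ) :
      H x y = 0 := by
    refine eq_zero_of_eq_zero_on_real (f := H x) ?_ (fun u hu => hleft u hu hx) hy
    refine hF.comp (f := fun y : ℂ => (z₀ + (x + Complex.I * y), conj z₀ + (x - Complex.I * y)))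
      (by fun_prop) fun y hy => hmaps hx hy
  rw [mem_ball_iff_norm] at ha hb
  have hx : (a - z₀ + (b - conj z₀)) / 2 ∈ Metric.ball (0 : ℂ) ρ := by
    have := norm_add_le (a - z₀) (b - conj z₀)
    rw [mem_ball_zero_iff, norm_div, Complex.norm_ofNat]
    linarith
  have hy : -Complex.I * (a - z₀ - (b - conj z₀)) / 2 ∈ Metric.ball (0 : ℂ) ρ := by
    have := norm_sub_le (a - z₀) (b - conj z₀)
    rw [mem_ball_zero_iff, norm_div, norm_mul, norm_neg, Complex.norm_I, one_mul,
      Complex.norm_ofNat]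
    linarith
  convert hall hx hy using 2
  ext
  · linear_combination (a - z₀ - (b - conj z₀)) / 2 * Complex.I_sq
  · linear_combination -(a - z₀ - (b - conj z₀)) / 2 * Complex.I_sq

open Polynomial in
/-- The squared norm of a nonzero finite family of polynomials is `‖z‖ ^ (2 * n)` times a
continuous function that is positive at `0`. -/
lemma exists_sum_norm_sq_eq_norm_pow_mul {ι : Type*} [Fintype ι] (q : ι → ℂ[X])
    (hq : ∃ i, q i ≠ 0) :
    ∃ (n : ℕ) (g : ℂ → ℝ), Continuous g ∧ 0 < g 0 ∧
      ∀ z, ∑ i, ‖(q i).eval z‖ ^ 2 = ‖z‖ ^ (2 * n) * g z := by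
  classical
  have hex : ∃ n, ∃ i, (q i).coeff n ≠ 0 := by
    obtain ⟨i, hi⟩ := hq
    exact ⟨_, i, leadingCoeff_ne_zero.mpr hi⟩
  let n := Nat.find hex
  obtain ⟨i₀, hi₀⟩ := Nat.find_spec hex
  have hdvd (i : ι) : X ^ n ∣ q i := by
    rw [X_pow_dvd_iff]
    intro d hd
    by_contra hne
    exact Nat.find_min hex hd ⟨i, hne⟩
  choose r hr using hdvd
  refine ⟨n, fun z => ∑ i, ‖(r i).eval z‖ ^ 2, by fun_prop, ?_, fun z => ?_⟩
  · refine Finset.sum_pos' (fun i _ => by positivity) ⟨i₀, Finset.mem_univ _, ?_⟩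
    have : (r i₀).eval 0 ≠ 0 := by
      rw [← coeff_zero_eq_eval_zero]
      intro h0
      apply hi₀
      have := coeff_X_pow_mul (r i₀) n 0
      rw [zero_add, ← hr, h0] at this
      exact this
    positivity
  · rw [Finset.mul_sum]
    refine Finset.sum_congr rfl fun i _ => ?_
    rw [hr i, eval_mul, eval_pow, eval_X, norm_mul, norm_pow]
    ring

open Polynomial in
/-- If a Hermitian polynomial is a quotient of squared norms of holomorphic functions on some
nonempty open set, then it is a quotient of squared norms of polynomials on `ℂ`. -/
lemma exists_polynomial_quotient {N : ℕ} (c : ℕ → ℕ → ℂ) (p : ℂ → ℝ)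
    (hp : ∀ z, (p z : ℂ) =
      ∑ j ∈ Finset.range N, ∑ k ∈ Finset.range N, c j k * z ^ j * (conj z) ^ k)
    {κ ι : Type*} [Fintype κ] [Fintype ι] (T : κ → ℂ → ℂ) (s : ι → ℂ → ℂ)
    {U : Set ℂ} (hU : IsOpen U)
    (hT : ∀ δ, DifferentiableOn ℂ (T δ) U) (hs : ∀ γ, DifferentiableOn ℂ (s γ) U)
    (hsne : ¬ ∀ z ∈ U, ∑ γ, ‖s γ z‖ ^ 2 = 0)
    (hquot : ∀ z ∈ U, p z * ∑ γ, ‖s γ z‖ ^ 2 = ∑ δ, ‖T δ z‖ ^ 2) :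
    ∃ (A : κ → ℂ[X]) (B : ι → ℂ[X]), (∃ γ, B γ ≠ 0) ∧
      ∀ z, p z * ∑ γ, ‖(B γ).eval z‖ ^ 2 = ∑ δ, ‖(A δ).eval z‖ ^ 2 := by
  obtain ⟨z₀, hz₀, γ₀, hγ₀⟩ : ∃ z₀ ∈ U, ∃ γ₀, s γ₀ z₀ ≠ 0 := by
    by_contra! hall
    exact hsne fun z hz => Finset.sum_eq_zero fun γ _ => by simp [hall z hz γ]
  obtain ⟨r, hr, hrU⟩ := Metric.isOpen_iff.mp hU z₀ hz₀
  obtain ⟨ρ, hρ, rfl⟩ : ∃ ρ > 0, r = 2 * ρ := ⟨r / 2, by linarith, by ring⟩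
  let P : ℂ → ℂ → ℂ := fun z w =>
    ∑ j ∈ Finset.range N, ∑ k ∈ Finset.range N, c j k * z ^ j * w ^ k
  have hconj {w : ℂ} (hw : w ∈ Metric.ball (conj z₀) (2 * ρ)) :
      conj w ∈ Metric.ball z₀ (2 * ρ) := by
    rw [mem_ball_iff_norm] at hw ⊢
    rw [← Complex.norm_conj]
    simpa using hw
  have hdiff_fst {f : ℂ → ℂ} (hf : DifferentiableOn ℂ f U) :
      DifferentiableOn ℂ (fun v : ℂ × ℂ => f v.1)
        (Metric.ball z₀ (2 * ρ) ×ˢ Metric.ball (conj z₀) (2 * ρ)) :=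
    hf.comp differentiableOn_fst fun v hv => hrU hv.1
  have hdiff_snd {f : ℂ → ℂ} (hf : DifferentiableOn ℂ f U) :
      DifferentiableOn ℂ (fun v : ℂ × ℂ => conj (f (conj v.2)))
        (Metric.ball z₀ (2 * ρ) ×ˢ Metric.ball (conj z₀) (2 * ρ)) := by
    have hg : DifferentiableOn ℂ (fun w : ℂ => conj (f (conj w)))
        (Metric.ball (conj z₀) (2 * ρ)) := fun w hw => by
      have hfw := (hf.differentiableAt (hU.mem_nhds (hrU (hconj hw)))).conj_conj
      rw [Complex.conj_conj] at hfw
      exact hfw.differentiableWithinAt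
    exact hg.comp differentiableOn_snd fun v hv => hv.2
  have hpolar {z w : ℂ} (hz : z ∈ Metric.ball z₀ ρ) (hw : w ∈ Metric.ball z₀ ρ) :
      P z (conj w) * ∑ γ, s γ z * conj (s γ w) = ∑ δ, T δ z * conj (T δ w) := by
    have hwc : conj w ∈ Metric.ball (conj z₀) ρ := by
      rw [mem_ball_iff_norm] at hw ⊢
      rwa [← map_sub, Complex.norm_conj]
    have key := eq_zero_of_eq_zero_on_conj (z₀ := z₀) (ρ := ρ)
      (F := fun v => P v.1 v.2 * ∑ γ, s γ v.1 * conj (s γ (conj v.2))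
        - ∑ δ, T δ v.1 * conj (T δ (conj v.2))) ?_ ?_ hz hwc
    · simpa [sub_eq_zero] using key
    · refine DifferentiableOn.sub (DifferentiableOn.mul (by fun_prop) ?_) ?_
      · exact DifferentiableOn.fun_sum fun γ _ => (hdiff_fst (hs γ)).mul (hdiff_snd (hs γ))
      · exact DifferentiableOn.fun_sum fun δ _ => (hdiff_fst (hT δ)).mul (hdiff_snd (hT δ))
    · intro z hz
      have := congrArg (fun t : ℝ => (t : ℂ)) (hquot z (hrU hz))
      simp only [Complex.ofReal_mul, Complex.ofReal_sum, Complex.ofReal_pow, hp] at this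
      simpa [P, Complex.mul_conj', sub_eq_zero] using this
  have hball : Metric.ball z₀ ρ ⊆ U := (Metric.ball_subset_ball (by linarith)).trans hrU
  obtain ⟨g, hg₀, hg⟩ := exists_polynomial_family_of_continuousOn
    (V := Metric.ball z₀ ρ) Metric.isOpen_ball (Sum.elim s T)
    (by
      rintro (γ | δ)
      · exact ((hs γ).mono hball).continuousOn
      · exact ((hT δ).mono hball).continuousOn)
    (Sum.inl γ₀) (Metric.mem_ball_self hρ) hγ₀
  have hrel (q : ℂ[X]) (a : ι → ℂ) (b : κ → ℂ)
      (h : ∀ z ∈ Metric.ball z₀ ρ, q.eval z * ∑ γ, s γ z * a γ = ∑ δ, T δ z * b δ) (z : ℂ) :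
      q.eval z * ∑ γ, (g (Sum.inl γ)).eval z * a γ = ∑ δ, (g (Sum.inr δ)).eval z * b δ := by
    have hzero := hg (Sum.elim (fun γ => q * C (a γ)) (fun δ => -C (b δ))) fun w hw => by
      have := h w hw
      simp only [Fintype.sum_sum_type, Sum.elim_inl, Sum.elim_inr, eval_mul, eval_C, eval_neg,
        neg_mul, Finset.sum_neg_distrib, ← sub_eq_add_neg, sub_eq_zero]
      rw [Finset.mul_sum] at this
      convert this using 2 <;> ring
    have := congrArg (eval z) hzero
    simp only [Fintype.sum_sum_type, Sum.elim_inl, Sum.elim_inr, eval_mul, eval_C,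
      neg_mul, Finset.sum_neg_distrib, ← sub_eq_add_neg, sub_eq_zero, eval_sub,
      eval_finsetSum, eval_zero] at this
    rw [Finset.mul_sum]
    convert this using 2 <;> ring
  have hfirst (z : ℂ) {w : ℂ} (hw : w ∈ Metric.ball z₀ ρ) :
      P z (conj w) * ∑ γ, (g (Sum.inl γ)).eval z * conj (s γ w) =
        ∑ δ, (g (Sum.inr δ)).eval z * conj (T δ w) := by
    have := hrel (∑ j ∈ Finset.range N, ∑ k ∈ Finset.range N, C (c j k * conj w ^ k) * X ^ j)
      (fun γ => conj (s γ w)) (fun δ => conj (T δ w)) ?_ z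
    · convert this using 2
      simp only [P, eval_finsetSum, eval_mul, eval_C, eval_pow, eval_X]
      exact Finset.sum_congr rfl fun j _ => Finset.sum_congr rfl fun k _ => by ring
    · intro z hz
      convert hpolar hz hw using 2
      simp only [P, eval_finsetSum, eval_mul, eval_C, eval_pow, eval_X]
      exact Finset.sum_congr rfl fun j _ => Finset.sum_congr rfl fun k _ => by ring
  have hsecond (z w : ℂ) :
      conj (P z (conj w)) * ∑ γ, (g (Sum.inl γ)).eval w * conj ((g (Sum.inl γ)).eval z) =
        ∑ δ, (g (Sum.inr δ)).eval w * conj ((g (Sum.inr δ)).eval z) := by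
    have hQ (w : ℂ) : eval w (∑ j ∈ Finset.range N, ∑ k ∈ Finset.range N,
        C (conj (c j k * z ^ j)) * X ^ k) = conj (P z (conj w)) := by
      simp [P, eval_finsetSum]
    have := hrel (∑ j ∈ Finset.range N, ∑ k ∈ Finset.range N, C (conj (c j k * z ^ j)) * X ^ k)
      (fun γ => conj ((g (Sum.inl γ)).eval z))
      (fun δ => conj ((g (Sum.inr δ)).eval z)) (fun w hw => ?_) w
    · rwa [hQ] at this
    · rw [hQ]
      have := congrArg conj (hfirst z hw)
      simpa [mul_comm] using this
  refine ⟨fun δ => g (Sum.inr δ), fun γ => g (Sum.inl γ), ⟨γ₀, hg₀⟩, fun z => ?_⟩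
  have := hsecond z z
  rw [show P z (conj z) = p z from (hp z).symm, Complex.conj_ofReal] at this
  simp only [Complex.mul_conj'] at this
  exact_mod_cast this

/-- The order of vanishing is unique. -/
lemma le_of_norm_pow_bounds {p : ℂ → ℝ} {m n : ℕ} {ε ε' C₁ C₂ : ℝ} (hε : 0 < ε) (hε' : 0 < ε')
    (hC₁ : 0 < C₁)
    (h₁ : ∀ z : ℂ, z ≠ 0 → ‖z‖ < ε → C₁ ≤ p z / ‖z‖ ^ (2 * m))
    (h₂ : ∀ z : ℂ, z ≠ 0 → ‖z‖ < ε' → p z / ‖z‖ ^ (2 * n) ≤ C₂) : n ≤ m := by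
  by_contra! hmn
  have hev : ∀ᶠ z : ℂ in nhdsWithin 0 {0}ᶜ, C₁ ≤ C₂ * ‖z‖ ^ (2 * (n - m)) := by
    filter_upwards [self_mem_nhdsWithin,
      nhdsWithin_le_nhds (Metric.ball_mem_nhds (0 : ℂ) (lt_min hε hε'))] with z hz hzε
    rw [mem_ball_zero_iff, lt_min_iff] at hzε
    have hz0 : 0 < ‖z‖ := norm_pos_iff.mpr hz
    have hlow := h₁ z hz hzε.1
    have hupp := h₂ z hz hzε.2
    rw [le_div_iff₀ (by positivity)] at hlow
    rw [div_le_iff₀ (by positivity)] at hupp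
    refine le_of_mul_le_mul_right ?_ (pow_pos hz0 (2 * m))
    rw [mul_assoc, ← pow_add, show 2 * (n - m) + 2 * m = 2 * n by omega]
    exact hlow.trans hupp
  have hlim : Filter.Tendsto (fun z : ℂ => C₂ * ‖z‖ ^ (2 * (n - m))) (nhdsWithin 0 {0}ᶜ)
      (nhds 0) := by
    have hcont : Continuous fun z : ℂ => C₂ * ‖z‖ ^ (2 * (n - m)) := by fun_prop
    refine (hcont.tendsto' 0 0 ?_).mono_left nhdsWithin_le_nhds
    simp [show n - m ≠ 0 by omega]
  exact absurd (ge_of_tendsto hlim hev) (not_le.mpr hC₁)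

theorem stmt_12 {NN : ℕ} (c : ℕ → ℕ → ℂ) (hc : ∀ j k, c j k = conj (c k j))
    (p : ℂ → ℝ)
    (hp : ∀ z, (p z : ℂ) =
      ∑ j ∈ Finset.range NN, ∑ k ∈ Finset.range NN, c j k * z ^ j * (conj z) ^ k)
    (hpos : ∀ z, 0 ≤ p z) (hne : ∃ z, p z ≠ 0)
    {M M' : ℕ} (T : Fin M → ℂ → ℂ) (s : Fin M' → ℂ → ℂ)
    (U : Set ℂ) (hU : IsOpen U) (h0 : (0 : ℂ) ∈ U)
    (hT : ∀ δ, DifferentiableOn ℂ (T δ) U)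
    (hs : ∀ γ, DifferentiableOn ℂ (s γ) U)
    (hsne : ¬ ∀ z ∈ U, ∑ γ, ‖s γ z‖ ^ 2 = 0)
    (hquot : ∀ z ∈ U, p z * ∑ γ, ‖s γ z‖ ^ 2 = ∑ δ, ‖T δ z‖ ^ 2) :
    ∃! m : ℕ, ∃ ε C₁ C₂ : ℝ, 0 < ε ∧ 0 < C₁ ∧
      ∀ z : ℂ, z ≠ 0 → ‖z‖ < ε →
        C₁ ≤ p z / ‖z‖ ^ (2 * m) ∧ p z / ‖z‖ ^ (2 * m) ≤ C₂ := by
  -- `U` need not be connected, so `s` may vanish near `0`; pass to polynomials on all of `ℂ`.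
  obtain ⟨A, B, ⟨γ₀, hγ₀⟩, hAB⟩ := exists_polynomial_quotient c p hp T s hU hT hs hsne hquot
  have hpc : Continuous fun z => (p z : ℂ) := by
    simp only [hp]
    fun_prop
  have hpcont : Continuous p := Complex.continuous_re.comp hpc
  have hA : ∃ δ, A δ ≠ 0 := by
    by_contra! hall
    obtain ⟨z₁, hz₁⟩ := hne
    refine hγ₀ (Polynomial.eq_zero_of_eval_mul_eq_zero isOpen_univ hpc.continuousOn
      (fun z _ => ?_) (Set.mem_univ z₁) (by exact_mod_cast hz₁))
    have hz := hAB z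
    simp only [hall, Polynomial.eval_zero, norm_zero, ne_eq, OfNat.ofNat_ne_zero,
      not_false_eq_true, zero_pow, Finset.sum_const_zero] at hz
    rcases mul_eq_zero.mp hz with h | h
    · simp [h]
    · rw [Finset.sum_eq_zero_iff_of_nonneg fun _ _ => by positivity] at h
      have := h γ₀ (Finset.mem_univ _)
      rw [norm_eq_zero.mp (pow_eq_zero_iff two_ne_zero |>.mp this), zero_mul]
  obtain ⟨a, g, hg, hg0, hga⟩ := exists_sum_norm_sq_eq_norm_pow_mul B ⟨γ₀, hγ₀⟩
  obtain ⟨b, h, hh, hh0, hhb⟩ := exists_sum_norm_sq_eq_norm_pow_mul A hA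
  simp only [hga, hhb] at hAB
  have hab : a ≤ b := by
    by_contra! hlt
    have hev : ∀ᶠ z : ℂ in nhdsWithin 0 {0}ᶜ, p z * ‖z‖ ^ (2 * (a - b)) * g z = h z := by
      filter_upwards [self_mem_nhdsWithin] with z hz
      have hz0 : 0 < ‖z‖ := norm_pos_iff.mpr hz
      refine mul_left_cancel₀ (pow_pos hz0 (2 * b)).ne' ?_
      rw [← hAB z, show 2 * a = 2 * b + 2 * (a - b) by omega, pow_add]
      ring
    have hcont : Continuous fun z : ℂ => p z * ‖z‖ ^ (2 * (a - b)) * g z := by fun_prop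
    have hl := (hcont.tendsto 0).mono_left (nhdsWithin_le_nhds (s := {0}ᶜ))
    have hr := (hh.tendsto 0).mono_left (nhdsWithin_le_nhds (s := {0}ᶜ))
    have := tendsto_nhds_unique (hl.congr' hev) hr
    simp [show a - b ≠ 0 by omega] at this
    linarith
  have hratio : ContinuousAt (fun z => h z / g z) 0 :=
    hh.continuousAt.div hg.continuousAt hg0.ne'
  have hL : 0 < h 0 / g 0 := div_pos hh0 hg0
  obtain ⟨ε, hε, hball⟩ := Metric.eventually_nhds_iff_ball.mp
    ((hg.continuousAt.eventually_const_lt hg0).and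
      ((hratio.eventually_const_lt (half_lt_self hL)).and
        (hratio.eventually_lt_const (lt_two_mul_self hL))))
  have hm : ∀ z : ℂ, z ≠ 0 → ‖z‖ < ε → h 0 / g 0 / 2 ≤ p z / ‖z‖ ^ (2 * (b - a)) ∧
      p z / ‖z‖ ^ (2 * (b - a)) ≤ 2 * (h 0 / g 0) := by
    intro z hz hzε
    obtain ⟨hgz, hlow, hupp⟩ := hball z (by simpa using hzε)
    have hz0 : 0 < ‖z‖ := norm_pos_iff.mpr hz
    have heq : p z / ‖z‖ ^ (2 * (b - a)) = h z / g z := by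
      rw [div_eq_div_iff (by positivity) hgz.ne']
      refine mul_left_cancel₀ (pow_pos hz0 (2 * a)).ne' ?_
      have := hAB z
      rw [show 2 * b = 2 * a + 2 * (b - a) by omega, pow_add] at this
      linear_combination this
    rw [heq]
    exact ⟨hlow.le, hupp.le⟩
  refine ⟨b - a, ⟨ε, _, _, hε, half_pos hL, hm⟩, ?_⟩
  rintro n ⟨ε', C₁, C₂, hε', hC₁, hn⟩
  exact le_antisymm
    (le_of_norm_pow_bounds hε hε' (half_pos hL) (fun z h₁ h₂ => (hm z h₁ h₂).1)
      fun z h₁ h₂ => (hn z h₁ h₂).2)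
    (le_of_norm_pow_bounds hε' hε hC₁ (fun z h₁ h₂ => (hn z h₁ h₂).1)
      fun z h₁ h₂ => (hm z h₁ h₂).2)
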